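/- Let R_x be the ℚ-subalgebra of A generated by {x_i : i ∈ ℤ} and R_y the ℚ-subalgebra generated by {y_i : i ∈ ℤ}. Then the ℚ-linear map ψ : R_x ⊗_ℚ R_y → A determined by f ⊗ g ↦ f·g (multiplication in A) is bijective. -/

import Mathlib

/-!
Statement 0. Fix a prime power `q`. Let `v = √q ∈ ℝ`, `K = ℚ(v) ⊆ ℝ`, and let `A` be the
`K`-algebra presented by generators `x i, y i` (`i ∈ ℤ`) and the nine families of relations
(1)–(9) of the paper.  Then there is a unique `K`-algebra homomorphism
`φ : A → K[x,x⁻¹]` with `φ (x i) = (v/(v²−1))·x` and `φ (y i) = (v/(v²−1))·x⁻¹` for all `i`.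
-/

noncomputable section

open FreeAlgebra

/-- The free algebra generator `x_i`. -/
abbrev xF (K : Type) [Field K] (i : ℤ) : FreeAlgebra K (ℤ ⊕ ℤ) :=
  FreeAlgebra.ι K (Sum.inl i)

/-- The free algebra generator `y_i`. -/
abbrev yF (K : Type) [Field K] (i : ℤ) : FreeAlgebra K (ℤ ⊕ ℤ) :=
  FreeAlgebra.ι K (Sum.inr i)

/-- The defining relations (1)–(9) of the algebra `A`, with parameter `q`. -/
inductive SphRel (K : Type) [Field K] (q : K) :
    FreeAlgebra K (ℤ ⊕ ℤ) → FreeAlgebra K (ℤ ⊕ ℤ) → Prop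
  | x1 (i : ℤ) : SphRel K q
      (xF K i * xF K i * xF K (i-1) - (1 + q⁻¹) • (xF K i * xF K (i-1) * xF K i)
        + q⁻¹ • (xF K (i-1) * xF K i * xF K i)) 0
  | x2 (i : ℤ) : SphRel K q
      (xF K i * xF K (i-1) * xF K (i-1) - (1 + q⁻¹) • (xF K (i-1) * xF K i * xF K (i-1))
        + q⁻¹ • (xF K (i-1) * xF K (i-1) * xF K i)) 0
  | x3 (i j : ℤ) (h : 1 < |i - j|) : SphRel K q (xF K i * xF K j) (xF K j * xF K i)
  | yx1 (i : ℤ) : SphRel K q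
      (yF K i * xF K i - q • (xF K i * yF K i) + (q / (q - 1)) • (1 : FreeAlgebra K (ℤ ⊕ ℤ))) 0
  | yx2 (i : ℤ) : SphRel K q
      (yF K i * xF K (i+1) - q⁻¹ • (xF K (i+1) * yF K i)
        - (1 / (q - 1)) • (1 : FreeAlgebra K (ℤ ⊕ ℤ))) 0
  | yx3 (i j : ℤ) (h1 : j ≠ i) (h2 : j ≠ i + 1) :
      SphRel K q (yF K i * xF K j) (xF K j * yF K i)
  | y1 (i : ℤ) : SphRel K q
      (yF K i * yF K i * yF K (i-1) - (1 + q⁻¹) • (yF K i * yF K (i-1) * yF K i)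
        + q⁻¹ • (yF K (i-1) * yF K i * yF K i)) 0
  | y2 (i : ℤ) : SphRel K q
      (yF K i * yF K (i-1) * yF K (i-1) - (1 + q⁻¹) • (yF K (i-1) * yF K i * yF K (i-1))
        + q⁻¹ • (yF K (i-1) * yF K (i-1) * yF K i)) 0
  | y3 (i j : ℤ) (h : 1 < |i - j|) : SphRel K q (yF K i * yF K j) (yF K j * yF K i)

/-- The algebra `A` presented by the generators `x_i, y_i` and the relations (1)–(9). -/
abbrev SphAlg (K : Type) [Field K] (q : K) : Type := RingQuot (SphRel K q)

/-- The generator `x_i` of `A`. -/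
abbrev xA (K : Type) [Field K] (q : K) (i : ℤ) : SphAlg K q :=
  RingQuot.mkAlgHom K (SphRel K q) (xF K i)

/-- The generator `y_i` of `A`. -/
abbrev yA (K : Type) [Field K] (q : K) (i : ℤ) : SphAlg K q :=
  RingQuot.mkAlgHom K (SphRel K q) (yF K i)

/-- `R_x`, the `ℚ`-subalgebra of `A` generated by the `x_i`. -/
abbrev Rx (q : ℚ) : Subalgebra ℚ (SphAlg ℚ q) :=
  Algebra.adjoin ℚ (Set.range fun i : ℤ => xA ℚ q i)

/-- `R_y`, the `ℚ`-subalgebra of `A` generated by the `y_i`. -/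
abbrev Ry (q : ℚ) : Subalgebra ℚ (SphAlg ℚ q) :=
  Algebra.adjoin ℚ (Set.range fun i : ℤ => yA ℚ q i)

/-- A family `f : ℤ → R` satisfying the quantum Serre relations of type `A_∞`. -/
structure IsSerreFamily (q : ℚ) {R : Type*} [Ring R] [Algebra ℚ R] (f : ℤ → R) : Prop where
  left (i : ℤ) : f i * f i * f (i-1) - (1 + q⁻¹) • (f i * f (i-1) * f i)
    + q⁻¹ • (f (i-1) * f i * f i) = 0
  right (i : ℤ) : f i * f (i-1) * f (i-1) - (1 + q⁻¹) • (f (i-1) * f i * f (i-1))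
    + q⁻¹ • (f (i-1) * f (i-1) * f i) = 0
  comm (i j : ℤ) (h : 1 < |i - j|) : f i * f j = f j * f i

/-- The quantum Serre relations in the free algebra on `ℤ`. -/
inductive SerreRel (q : ℚ) : FreeAlgebra ℚ ℤ → FreeAlgebra ℚ ℤ → Prop
  | left (i : ℤ) : SerreRel q
      (ι ℚ i * ι ℚ i * ι ℚ (i-1) - (1 + q⁻¹) • (ι ℚ i * ι ℚ (i-1) * ι ℚ i)
        + q⁻¹ • (ι ℚ (i-1) * ι ℚ i * ι ℚ i)) 0
  | right (i : ℤ) : SerreRel q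
      (ι ℚ i * ι ℚ (i-1) * ι ℚ (i-1) - (1 + q⁻¹) • (ι ℚ (i-1) * ι ℚ i * ι ℚ (i-1))
        + q⁻¹ • (ι ℚ (i-1) * ι ℚ (i-1) * ι ℚ i)) 0
  | comm (i j : ℤ) (h : 1 < |i - j|) : SerreRel q (ι ℚ i * ι ℚ j) (ι ℚ j * ι ℚ i)

/-- The algebra presented by generators indexed by `ℤ` and the quantum Serre relations. -/
def SerreAlg (q : ℚ) : Type := RingQuot (SerreRel q)

instance (q : ℚ) : Ring (SerreAlg q) := inferInstanceAs (Ring (RingQuot (SerreRel q)))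

instance (q : ℚ) : Algebra ℚ (SerreAlg q) :=
  inferInstanceAs (Algebra ℚ (RingQuot (SerreRel q)))

namespace SerreAlg

variable {q : ℚ} {R : Type*} [Ring R] [Algebra ℚ R]

/-- The quotient map from the free algebra. -/
def mk (q : ℚ) : FreeAlgebra ℚ ℤ →ₐ[ℚ] SerreAlg q := RingQuot.mkAlgHom ℚ (SerreRel q)

theorem mk_surjective (q : ℚ) : Function.Surjective (mk q) := RingQuot.mkAlgHom_surjective ℚ _

theorem mk_rel {a b : FreeAlgebra ℚ ℤ} (h : SerreRel q a b) : mk q a = mk q b :=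
  RingQuot.mkAlgHom_rel ℚ h

/-- The generators of `SerreAlg q`. -/
def gen (q : ℚ) (i : ℤ) : SerreAlg q := mk q (ι ℚ i)

theorem isSerreFamily_gen (q : ℚ) : IsSerreFamily q (gen q) where
  left i := by simpa [gen] using mk_rel (SerreRel.left (q := q) i)
  right i := by simpa [gen] using mk_rel (SerreRel.right (q := q) i)
  comm i j h := by simpa [gen] using mk_rel (SerreRel.comm (q := q) i j h)

/-- The universal property of `SerreAlg q`. -/
def lift {f : ℤ → R} (hf : IsSerreFamily q f) : SerreAlg q →ₐ[ℚ] R :=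
  RingQuot.liftAlgHom ℚ ⟨FreeAlgebra.lift ℚ f, by
    rintro _ _ (i | i | ⟨i, j, h⟩)
    · simpa using hf.left i
    · simpa using hf.right i
    · simpa using hf.comm i j h⟩

@[simp]
theorem lift_gen {f : ℤ → R} (hf : IsSerreFamily q f) (i : ℤ) : lift hf (gen q i) = f i :=
  (RingQuot.liftAlgHom_mkAlgHom_apply ℚ _ _ _).trans (FreeAlgebra.lift_ι_apply f i)

theorem adjoin_range_gen (q : ℚ) : Algebra.adjoin ℚ (Set.range (gen q)) = ⊤ := by
  have h : Set.range (gen q) =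
      Set.image (mk q) (Set.range (ι ℚ : ℤ → FreeAlgebra ℚ ℤ)) := by
    rw [← Set.range_comp]; rfl
  rw [h, ← AlgHom.map_adjoin, FreeAlgebra.adjoin_range_ι, Algebra.map_top,
    AlgHom.range_eq_top]
  exact mk_surjective q

theorem range_lift {f : ℤ → R} (hf : IsSerreFamily q f) :
    (lift hf).range = Algebra.adjoin ℚ (Set.range f) := by
  rw [← Algebra.map_top, ← adjoin_range_gen, AlgHom.map_adjoin, ← Set.range_comp]
  congr 2
  ext i
  simp

/-- A submodule containing `1` and stable under left multiplication by generators is everything. -/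
theorem mem_of_one_mem_of_gen_mul_mem {p : Submodule ℚ (SerreAlg q)} (one : 1 ∈ p)
    (gen_mul : ∀ i, ∀ f ∈ p, gen q i * f ∈ p) (f : SerreAlg q) : f ∈ p := by
  have key : ∀ a ∈ Algebra.adjoin ℚ (Set.range (gen q)), ∀ f ∈ p, a * f ∈ p := by
    intro a ha
    induction ha using Algebra.adjoin_induction with
    | mem x hx =>
      obtain ⟨i, rfl⟩ := hx
      exact gen_mul i
    | algebraMap r =>
      intro f hf
      rw [← Algebra.smul_def]
      exact p.smul_mem r hf
    | add x y _ _ hx hy =>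
      intro f hf
      rw [add_mul]
      exact p.add_mem (hx f hf) (hy f hf)
    | mul x y _ _ hx hy =>
      intro f hf
      rw [mul_assoc]
      exact hx _ (hy f hf)
  simpa using key f (by rw [adjoin_range_gen]; trivial) 1 one

end SerreAlg

/-- The coefficient of `x_j y_i` in `y_i x_j`. -/
def crossCoeff (q : ℚ) (i j : ℤ) : ℚ := if j = i then q else if j = i + 1 then q⁻¹ else 1

/-- The constant term of `y_i x_j`. -/
def crossConst (q : ℚ) (i j : ℤ) : ℚ :=
  if j = i then -(q / (q - 1)) else if j = i + 1 then 1 / (q - 1) else 0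

section SerreCalculus

variable {R : Type*} [Ring R] [Algebra ℚ R] {p a b d e : ℚ} {x y z : R}

theorem serre_left_mul_of_cross (hy : y * x = a • (x * y) + d • 1)
    (hz : z * x = b • (x * z) + e • 1)
    (h₁ : e * (1 - (1 + p) * a + p * a ^ 2) = 0) (h₂ : d * (b * (a + 1) - (1 + p)) = 0)
    (h₃ : d * (p * (a + 1) - (1 + p) * a * b) = 0) :
    (y * y * z - (1 + p) • (y * z * y) + p • (z * y * y)) * x =
      (a ^ 2 * b) • (x * (y * y * z - (1 + p) • (y * z * y) + p • (z * y * y))) := by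
  have hy' (w : R) : y * (x * w) = a • (x * (y * w)) + d • w := by
    rw [← mul_assoc, hy]; simp [add_mul, mul_assoc]
  have hz' (w : R) : z * (x * w) = b • (x * (z * w)) + e • w := by
    rw [← mul_assoc, hz]; simp [add_mul, mul_assoc]
  simp only [mul_add, add_mul, mul_sub, sub_mul, smul_mul_assoc, mul_smul_comm, mul_assoc, hy, hz,
    hy', hz', mul_one]
  linear_combination (norm := module) h₁ • (y * y) + h₂ • (y * z) + h₃ • (z * y)

theorem serre_right_mul_of_cross (hy : y * x = a • (x * y) + d • 1)
    (hz : z * x = b • (x * z) + e • 1)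
    (h₁ : d * (b ^ 2 - (1 + p) * b + p) = 0) (h₂ : e * (1 + b - (1 + p) * a * b) = 0)
    (h₃ : e * (p * a * (b + 1) - (1 + p)) = 0) :
    (y * z * z - (1 + p) • (z * y * z) + p • (z * z * y)) * x =
      (a * b ^ 2) • (x * (y * z * z - (1 + p) • (z * y * z) + p • (z * z * y))) := by
  have hy' (w : R) : y * (x * w) = a • (x * (y * w)) + d • w := by
    rw [← mul_assoc, hy]; simp [add_mul, mul_assoc]
  have hz' (w : R) : z * (x * w) = b • (x * (z * w)) + e • w := by
    rw [← mul_assoc, hz]; simp [add_mul, mul_assoc]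
  simp only [mul_add, add_mul, mul_sub, sub_mul, smul_mul_assoc, mul_smul_comm, mul_assoc, hy, hz,
    hy', hz', mul_one]
  linear_combination (norm := module) h₁ • (z * z) + h₂ • (y * z) + h₃ • (z * y)

theorem commutator_mul_of_cross (hy : y * x = a • (x * y) + d • 1)
    (hz : z * x = b • (x * z) + e • 1) (h₁ : d * (b - 1) = 0) (h₂ : e * (a - 1) = 0) :
    (y * z - z * y) * x = (a * b) • (x * (y * z - z * y)) := by
  have hy' (w : R) : y * (x * w) = a • (x * (y * w)) + d • w := by
    rw [← mul_assoc, hy]; simp [add_mul, mul_assoc]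
  have hz' (w : R) : z * (x * w) = b • (x * (z * w)) + e • w := by
    rw [← mul_assoc, hz]; simp [add_mul, mul_assoc]
  simp only [mul_add, mul_sub, sub_mul, mul_smul_comm, mul_assoc, hy, hz,
    hy', hz', mul_one]
  linear_combination (norm := module) h₁ • z - h₂ • y

end SerreCalculus

theorem isSerreFamily_matrix {R : Type*} [Ring R] [Algebra ℚ R] {q : ℚ} (hq : q ≠ 0)
    {f : ℤ → R} (hf : IsSerreFamily q f) (i : ℤ) :
    IsSerreFamily q (fun j => !![crossCoeff q i j • f j, crossConst q i j • (1 : R); 0, f j]) where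
  left j := by
    have h := hf.left j
    have h₁ : crossConst q i (j-1) * (crossCoeff q i j ^ 2 - (1 + q⁻¹) * crossCoeff q i j + q⁻¹)
        = 0 := by
      unfold crossCoeff crossConst; split_ifs <;> first | omega | (field_simp; ring)
    have h₂ : crossConst q i j * (1 + crossCoeff q i j
        - (1 + q⁻¹) * crossCoeff q i j * crossCoeff q i (j-1)) = 0 := by
      unfold crossCoeff crossConst; split_ifs <;> first | omega | (field_simp; ring)
    have h₃ : crossConst q i j * (q⁻¹ * crossCoeff q i (j-1) * (crossCoeff q i j + 1)
        - (1 + q⁻¹)) = 0 := by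
      unfold crossCoeff crossConst; split_ifs <;> first | omega | (field_simp; ring)
    generalize crossCoeff q i j = a, crossCoeff q i (j-1) = b, crossConst q i j = d,
      crossConst q i (j-1) = e, f j = x, f (j-1) = z at *
    ext k l
    fin_cases k <;> fin_cases l <;>
      simp [add_mul, mul_assoc, -smul_add] at h ⊢
    · linear_combination (norm := module) (a ^ 2 * b) • h
    · linear_combination (norm := module) h₁ • (x * x) + h₂ • (x * z) + h₃ • (z * x)
    · exact h
  right j := by
    have h := hf.right j
    have h₁ : crossConst q i j * (1 - (1 + q⁻¹) * crossCoeff q i (j-1)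
        + q⁻¹ * crossCoeff q i (j-1) ^ 2) = 0 := by
      unfold crossCoeff crossConst; split_ifs <;> first | omega | (field_simp; ring)
    have h₂ : crossConst q i (j-1) * (crossCoeff q i j * (crossCoeff q i (j-1) + 1)
        - (1 + q⁻¹)) = 0 := by
      unfold crossCoeff crossConst; split_ifs <;> first | omega | (field_simp; ring)
    have h₃ : crossConst q i (j-1) * (q⁻¹ * (crossCoeff q i (j-1) + 1)
        - (1 + q⁻¹) * crossCoeff q i j * crossCoeff q i (j-1)) = 0 := by
      unfold crossCoeff crossConst; split_ifs <;> first | omega | (field_simp; ring)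
    generalize crossCoeff q i j = a, crossCoeff q i (j-1) = b, crossConst q i j = d,
      crossConst q i (j-1) = e, f j = x, f (j-1) = z at *
    ext k l
    fin_cases k <;> fin_cases l <;>
      simp [add_mul, mul_assoc, -smul_add] at h ⊢
    · linear_combination (norm := module) (a * b ^ 2) • h
    · linear_combination (norm := module) h₁ • (z * z) + h₂ • (x * z) + h₃ • (z * x)
    · exact h
  comm j k hjk := by
    have h := hf.comm j k hjk
    rw [lt_abs] at hjk
    have h₁ : crossConst q i j * (crossCoeff q i k - 1) = 0 := by
      unfold crossCoeff crossConst; split_ifs <;> first | omega | ring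
    have h₂ : crossConst q i k * (crossCoeff q i j - 1) = 0 := by
      unfold crossCoeff crossConst; split_ifs <;> first | omega | ring
    generalize crossCoeff q i j = a, crossCoeff q i k = b, crossConst q i j = d,
      crossConst q i k = e, f j = x, f k = z at *
    ext k l
    fin_cases k <;> fin_cases l <;>
      simp [Matrix.mul_apply, Fin.sum_univ_two]
    · linear_combination (norm := module) (a * b) • h
    · linear_combination (norm := module) h₂ • x - h₁ • z
    · exact h

namespace SerreAlg

variable {q : ℚ}

/-- The matrix representation encoding the twist and the skew derivation by which `y_i` acts. -/
def crossRep (hq : q ≠ 0) (i : ℤ) : SerreAlg q →ₐ[ℚ] Matrix (Fin 2) (Fin 2) (SerreAlg q) :=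
  lift (isSerreFamily_matrix hq (isSerreFamily_gen q) i)

theorem crossRep_snd (hq : q ≠ 0) (i : ℤ) (f : SerreAlg q) :
    crossRep hq i f 1 0 = 0 ∧ crossRep hq i f 1 1 = f := by
  let p : Submodule ℚ (SerreAlg q) :=
    { carrier := {f | crossRep hq i f 1 0 = 0 ∧ crossRep hq i f 1 1 = f}
      add_mem' := by rintro a b ⟨ha, ha'⟩ ⟨hb, hb'⟩; simp_all
      zero_mem' := by simp
      smul_mem' := by rintro c a ⟨ha, ha'⟩; simp_all }
  refine mem_of_one_mem_of_gen_mul_mem (p := p) ?_ ?_ f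
  · exact ⟨by simp, by simp⟩
  · rintro j g ⟨hg, hg'⟩
    refine ⟨?_, ?_⟩ <;> simp [crossRep, Matrix.mul_apply, Fin.sum_univ_two] <;>
      simp_all [crossRep]

/-- The twist through which `y_i` passes elements of the `x`-part. -/
def twist (hq : q ≠ 0) (i : ℤ) : SerreAlg q →ₗ[ℚ] SerreAlg q :=
  Matrix.entryLinearMap ℚ (SerreAlg q) 0 0 ∘ₗ (crossRep hq i).toLinearMap

/-- The skew derivation by which `y_i` acts on the `x`-part. -/
def skewDer (hq : q ≠ 0) (i : ℤ) : SerreAlg q →ₗ[ℚ] SerreAlg q :=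
  Matrix.entryLinearMap ℚ (SerreAlg q) 0 1 ∘ₗ (crossRep hq i).toLinearMap

@[simp]
theorem twist_one (hq : q ≠ 0) (i : ℤ) : twist hq i 1 = 1 := by simp [twist]

@[simp]
theorem skewDer_one (hq : q ≠ 0) (i : ℤ) : skewDer hq i 1 = 0 := by simp [skewDer]

theorem twist_gen_mul (hq : q ≠ 0) (i j : ℤ) (f : SerreAlg q) :
    twist hq i (gen q j * f) = crossCoeff q i j • (gen q j * twist hq i f) := by
  have h := (crossRep_snd hq i f).1
  simp only [twist, crossRep, LinearMap.comp_apply, AlgHom.toLinearMap_apply, map_mul, lift_gen,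
    Matrix.entryLinearMap_apply, Matrix.mul_apply, Fin.sum_univ_two] at h ⊢
  simp [h]

theorem skewDer_gen_mul (hq : q ≠ 0) (i j : ℤ) (f : SerreAlg q) :
    skewDer hq i (gen q j * f) =
      crossCoeff q i j • (gen q j * skewDer hq i f) + crossConst q i j • f := by
  have h := (crossRep_snd hq i f).2
  simp only [skewDer, crossRep, LinearMap.comp_apply, AlgHom.toLinearMap_apply, map_mul, lift_gen,
    Matrix.entryLinearMap_apply, Matrix.mul_apply, Fin.sum_univ_two] at h ⊢
  simp [h]

open TensorProduct

/-- The action of `x_j` on `SerreAlg q ⊗ SerreAlg q`. -/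
def xAct (q : ℚ) (j : ℤ) : Module.End ℚ (SerreAlg q ⊗[ℚ] SerreAlg q) :=
  TensorProduct.map (LinearMap.mulLeft ℚ (gen q j)) LinearMap.id

/-- The action of `y_i` on `SerreAlg q ⊗ SerreAlg q`. -/
def yAct (hq : q ≠ 0) (i : ℤ) : Module.End ℚ (SerreAlg q ⊗[ℚ] SerreAlg q) :=
  TensorProduct.map (twist hq i) (LinearMap.mulLeft ℚ (gen q i)) +
    TensorProduct.map (skewDer hq i) LinearMap.id

@[simp]
theorem xAct_tmul (j : ℤ) (f g : SerreAlg q) : xAct q j (f ⊗ₜ g) = (gen q j * f) ⊗ₜ g := rfl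

theorem yAct_tmul (hq : q ≠ 0) (i : ℤ) (f g : SerreAlg q) :
    yAct hq i (f ⊗ₜ g) = twist hq i f ⊗ₜ (gen q i * g) + skewDer hq i f ⊗ₜ g := rfl

@[simp]
theorem yAct_one_tmul (hq : q ≠ 0) (i : ℤ) (g : SerreAlg q) :
    yAct hq i (1 ⊗ₜ g) = 1 ⊗ₜ (gen q i * g) := by
  simp [yAct_tmul]

theorem yAct_mul_xAct (hq : q ≠ 0) (i j : ℤ) :
    yAct hq i * xAct q j = crossCoeff q i j • (xAct q j * yAct hq i) + crossConst q i j • 1 := by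
  ext f g
  simp [yAct_tmul, twist_gen_mul, skewDer_gen_mul, smul_tmul', add_tmul, add_assoc]

theorem isSerreFamily_xAct (q : ℚ) : IsSerreFamily q (xAct q) where
  left i := by
    ext f g
    have h := congr((($((isSerreFamily_gen q).left i)) * f) ⊗ₜ[ℚ] g)
    simpa [add_mul, sub_mul, add_tmul, sub_tmul, smul_tmul', mul_assoc] using h
  right i := by
    ext f g
    have h := congr((($((isSerreFamily_gen q).right i)) * f) ⊗ₜ[ℚ] g)
    simpa [add_mul, sub_mul, add_tmul, sub_tmul, smul_tmul', mul_assoc] using h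
  comm i j hij := by
    ext f g
    have h := congr((($((isSerreFamily_gen q).comm i j hij)) * f) ⊗ₜ[ℚ] g)
    simpa [mul_assoc] using h

/-- An endomorphism which skew-commutes with all `x_j` and kills `1 ⊗ g` for all `g` vanishes. -/
theorem eq_zero_of_mul_xAct {r : Module.End ℚ (SerreAlg q ⊗[ℚ] SerreAlg q)} (c : ℤ → ℚ)
    (hr : ∀ j, r * xAct q j = c j • (xAct q j * r)) (h1 : ∀ g, r (1 ⊗ₜ g) = 0) : r = 0 := by
  ext f g
  let p : Submodule ℚ (SerreAlg q) := LinearMap.ker (r ∘ₗ (TensorProduct.mk ℚ _ _).flip g)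
  refine mem_of_one_mem_of_gen_mul_mem (p := p) (h1 g) (fun j f hf => ?_) f
  have hf' : r (f ⊗ₜ g) = 0 := hf
  have h := congr($(hr j) (f ⊗ₜ g))
  simp only [Module.End.mul_apply, xAct_tmul, LinearMap.smul_apply, hf', map_zero, smul_zero] at h
  exact h

theorem isSerreFamily_yAct (hq : q ≠ 0) : IsSerreFamily q (yAct hq) where
  left i := by
    refine eq_zero_of_mul_xAct (fun j => crossCoeff q i j ^ 2 * crossCoeff q (i-1) j)
      (fun j => serre_left_mul_of_cross (yAct_mul_xAct hq i j) (yAct_mul_xAct hq (i-1) j)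
        ?_ ?_ ?_) fun g => ?_
    iterate 3
      unfold crossCoeff crossConst; split_ifs <;> first | omega | (field_simp; ring)
    have h := congr((1 : SerreAlg q) ⊗ₜ[ℚ] ($((isSerreFamily_gen q).left i) * g))
    simpa [add_mul, sub_mul, tmul_add, tmul_sub, mul_assoc] using h
  right i := by
    refine eq_zero_of_mul_xAct (fun j => crossCoeff q i j * crossCoeff q (i-1) j ^ 2)
      (fun j => serre_right_mul_of_cross (yAct_mul_xAct hq i j) (yAct_mul_xAct hq (i-1) j)
        ?_ ?_ ?_) fun g => ?_
    iterate 3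
      unfold crossCoeff crossConst; split_ifs <;> first | omega | (field_simp; ring)
    have h := congr((1 : SerreAlg q) ⊗ₜ[ℚ] ($((isSerreFamily_gen q).right i) * g))
    simpa [add_mul, sub_mul, tmul_add, tmul_sub, mul_assoc] using h
  comm i k hik := by
    rw [← sub_eq_zero]
    refine eq_zero_of_mul_xAct (fun j => crossCoeff q i j * crossCoeff q k j)
      (fun j => commutator_mul_of_cross (yAct_mul_xAct hq i j) (yAct_mul_xAct hq k j)
        ?_ ?_) fun g => ?_
    iterate 2
      rw [lt_abs] at hik
      unfold crossCoeff crossConst; split_ifs <;> first | omega | ring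
    have h := congr((1 : SerreAlg q) ⊗ₜ[ℚ] ($((isSerreFamily_gen q).comm i k hik) * g))
    simpa [mul_assoc, sub_eq_zero] using h

end SerreAlg

namespace SphAlg

open SerreAlg TensorProduct

variable {q : ℚ}

theorem isSerreFamily_xA (q : ℚ) : IsSerreFamily q (xA ℚ q) where
  left i := by simpa using RingQuot.mkAlgHom_rel ℚ (SphRel.x1 (q := q) i)
  right i := by simpa using RingQuot.mkAlgHom_rel ℚ (SphRel.x2 (q := q) i)
  comm i j h := by simpa using RingQuot.mkAlgHom_rel ℚ (SphRel.x3 (q := q) i j h)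

theorem isSerreFamily_yA (q : ℚ) : IsSerreFamily q (yA ℚ q) where
  left i := by simpa using RingQuot.mkAlgHom_rel ℚ (SphRel.y1 (q := q) i)
  right i := by simpa using RingQuot.mkAlgHom_rel ℚ (SphRel.y2 (q := q) i)
  comm i j h := by simpa using RingQuot.mkAlgHom_rel ℚ (SphRel.y3 (q := q) i j h)

theorem yA_mul_xA (q : ℚ) (i j : ℤ) :
    yA ℚ q i * xA ℚ q j = crossCoeff q i j • (xA ℚ q j * yA ℚ q i) + crossConst q i j • 1 := by
  unfold crossCoeff crossConst
  split_ifs with h₁ h₂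
  · subst h₁
    have h := RingQuot.mkAlgHom_rel ℚ (SphRel.yx1 (q := q) j)
    simp only [map_add, map_sub, map_mul, map_smul, map_one, map_zero] at h
    linear_combination (norm := module) h
  · subst h₂
    have h := RingQuot.mkAlgHom_rel ℚ (SphRel.yx2 (q := q) i)
    simp only [map_sub, map_mul, map_smul, map_one, map_zero] at h
    linear_combination (norm := module) h
  · simpa using RingQuot.mkAlgHom_rel ℚ (SphRel.yx3 (q := q) i j h₁ h₂)

/-- The representation of `A` on the tensor product of two copies of `SerreAlg q`. -/
def rep (hq : q ≠ 0) : SphAlg ℚ q →ₐ[ℚ] Module.End ℚ (SerreAlg q ⊗[ℚ] SerreAlg q) :=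
  RingQuot.liftAlgHom ℚ ⟨FreeAlgebra.lift ℚ (Sum.elim (xAct q) (yAct hq)), by
    rintro _ _ (i | i | ⟨i, j, h⟩ | i | i | ⟨i, j, h₁, h₂⟩ | i | i | ⟨i, j, h⟩)
    · simpa using (isSerreFamily_xAct q).left i
    · simpa using (isSerreFamily_xAct q).right i
    · simpa using (isSerreFamily_xAct q).comm i j h
    · have h := yAct_mul_xAct hq i i
      simp only [crossCoeff, crossConst, if_true] at h
      simp only [map_add, map_sub, map_mul, map_smul, map_one, map_zero, FreeAlgebra.lift_ι_apply,
        Sum.elim_inl, Sum.elim_inr, h]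
      module
    · have h := yAct_mul_xAct hq i (i + 1)
      simp only [crossCoeff, crossConst, if_true, add_eq_left, one_ne_zero, if_false] at h
      simp only [map_sub, map_mul, map_smul, map_one, map_zero, FreeAlgebra.lift_ι_apply,
        Sum.elim_inl, Sum.elim_inr, h]
      module
    · simp [yAct_mul_xAct, crossCoeff, crossConst, h₁, h₂]
    · simpa using (isSerreFamily_yAct hq).left i
    · simpa using (isSerreFamily_yAct hq).right i
    · simpa using (isSerreFamily_yAct hq).comm i j h⟩

@[simp]
theorem rep_xA (hq : q ≠ 0) (i : ℤ) : rep hq (xA ℚ q i) = xAct q i := by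
  simp [rep, xA]

@[simp]
theorem rep_yA (hq : q ≠ 0) (i : ℤ) : rep hq (yA ℚ q i) = yAct hq i := by
  simp [rep, yA]

theorem rep_lift_xA (hq : q ≠ 0) (f g h : SerreAlg q) :
    rep hq (lift (isSerreFamily_xA q) f) (g ⊗ₜ h) = (f * g) ⊗ₜ h := by
  let p : Submodule ℚ (SerreAlg q) := LinearMap.eqLocus
    ((LinearMap.applyₗ (g ⊗ₜ[ℚ] h)) ∘ₗ ((rep hq).comp (lift (isSerreFamily_xA q))).toLinearMap)
    ((TensorProduct.mk ℚ _ _).flip h ∘ₗ LinearMap.mulRight ℚ g)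
  refine mem_of_one_mem_of_gen_mul_mem (p := p) ?_ (fun j f hf => ?_) f
  · simp [p]
  · simp only [p, LinearMap.mem_eqLocus] at hf ⊢
    simp at hf ⊢
    simp [hf, mul_assoc]

theorem rep_lift_yA (hq : q ≠ 0) (g : SerreAlg q) :
    rep hq (lift (isSerreFamily_yA q) g) (1 ⊗ₜ 1) = 1 ⊗ₜ g := by
  let p : Submodule ℚ (SerreAlg q) := LinearMap.eqLocus
    ((LinearMap.applyₗ (1 ⊗ₜ[ℚ] 1)) ∘ₗ ((rep hq).comp (lift (isSerreFamily_yA q))).toLinearMap)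
    (TensorProduct.mk ℚ _ _ 1)
  refine mem_of_one_mem_of_gen_mul_mem (p := p) ?_ (fun j f hf => ?_) g
  · simp [p]
  · simp only [p, LinearMap.mem_eqLocus] at hf ⊢
    simp at hf ⊢
    simp [hf]

theorem mulMap_injective (hq : q ≠ 0) :
    Function.Injective (Submodule.mulMap (Subalgebra.toSubmodule (Rx q))
      (Subalgebra.toSubmodule (Ry q))) := by
  have hx (f) : lift (isSerreFamily_xA q) f ∈ Rx q := by
    exact (range_lift (isSerreFamily_xA q)).le ⟨f, rfl⟩
  have hy (f) : lift (isSerreFamily_yA q) f ∈ Ry q := by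
    exact (range_lift (isSerreFamily_yA q)).le ⟨f, rfl⟩
  let φ : SerreAlg q →ₗ[ℚ] Subalgebra.toSubmodule (Rx q) :=
    (lift (isSerreFamily_xA q)).toLinearMap.codRestrict _ hx
  let ψ : SerreAlg q →ₗ[ℚ] Subalgebra.toSubmodule (Ry q) :=
    (lift (isSerreFamily_yA q)).toLinearMap.codRestrict _ hy
  have hφ : Function.Surjective φ := by
    rintro ⟨a, ha⟩
    have ha' : a ∈ (lift (isSerreFamily_xA q)).range := by rwa [range_lift]
    obtain ⟨f, rfl⟩ := ha'
    exact ⟨f, rfl⟩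
  have hψ : Function.Surjective ψ := by
    rintro ⟨a, ha⟩
    have ha' : a ∈ (lift (isSerreFamily_yA q)).range := by rwa [range_lift]
    obtain ⟨f, rfl⟩ := ha'
    exact ⟨f, rfl⟩
  have hsurj := TensorProduct.map_surjective hφ hψ
  have hid : ((LinearMap.applyₗ (1 ⊗ₜ[ℚ] 1)) ∘ₗ (rep hq).toLinearMap ∘ₗ
      Submodule.mulMap (Subalgebra.toSubmodule (Rx q)) (Subalgebra.toSubmodule (Ry q))) ∘ₗ
        TensorProduct.map φ ψ = LinearMap.id := by
    ext f g
    have e : rep hq (lift (isSerreFamily_xA q) f * lift (isSerreFamily_yA q) g) (1 ⊗ₜ 1) =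
        f ⊗ₜ g := by
      rw [map_mul, Module.End.mul_apply, rep_lift_yA, rep_lift_xA, mul_one]
    exact e
  intro s t hst
  obtain ⟨s, rfl⟩ := hsurj s
  obtain ⟨t, rfl⟩ := hsurj t
  have hs := congr($hid s)
  have ht := congr($hid t)
  simp only [LinearMap.comp_apply, LinearMap.id_apply] at hs ht
  rw [← hs, ← ht, hst]

theorem exists_yA_mul_eq (i : ℤ) {f : SphAlg ℚ q} (hf : f ∈ Rx q) :
    ∃ g ∈ Rx q, ∃ h ∈ Rx q, yA ℚ q i * f = g * yA ℚ q i + h := by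
  induction hf using Algebra.adjoin_induction with
  | mem x hx =>
    obtain ⟨j, rfl⟩ := hx
    exact ⟨_, (Rx q).smul_mem (Algebra.subset_adjoin ⟨j, rfl⟩) (crossCoeff q i j), _,
      (Rx q).smul_mem (Rx q).one_mem (crossConst q i j), by simpa using yA_mul_xA q i j⟩
  | algebraMap r =>
    exact ⟨_, (Rx q).algebraMap_mem r, 0, (Rx q).zero_mem, by
      rw [add_zero, Algebra.commutes]⟩
  | add a b _ _ ha hb =>
    obtain ⟨g, hg, h, hh, e⟩ := ha
    obtain ⟨g', hg', h', hh', e'⟩ := hb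
    exact ⟨_, add_mem hg hg', _, add_mem hh hh', by rw [mul_add, e, e']; noncomm_ring⟩
  | mul a b ha' hb' ha hb =>
    obtain ⟨g, hg, h, hh, e⟩ := ha
    obtain ⟨g', hg', h', hh', e'⟩ := hb
    exact ⟨_, mul_mem hg hg', _, add_mem (mul_mem hg hh') (mul_mem hh hb'), by
      rw [← mul_assoc, e, add_mul, mul_assoc, e']; noncomm_ring⟩

theorem adjoin_range_xA_union_range_yA (q : ℚ) :
    Algebra.adjoin ℚ (Set.range (xA ℚ q) ∪ Set.range (yA ℚ q)) = ⊤ := by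
  have h : Set.range (xA ℚ q) ∪ Set.range (yA ℚ q) =
      Set.image (RingQuot.mkAlgHom ℚ (SphRel ℚ q))
        (Set.range (ι ℚ : ℤ ⊕ ℤ → FreeAlgebra ℚ (ℤ ⊕ ℤ))) := by
    rw [← Set.range_comp, ← Set.Sum.elim_range]
    congr 1
    ext (i | i) <;> rfl
  rw [h, ← AlgHom.map_adjoin, FreeAlgebra.adjoin_range_ι, Algebra.map_top,
    AlgHom.range_eq_top]
  exact RingQuot.mkAlgHom_surjective ℚ _

theorem toSubmodule_Rx_mul_toSubmodule_Ry (q : ℚ) :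
    Subalgebra.toSubmodule (Rx q) * Subalgebra.toSubmodule (Ry q) = ⊤ := by
  set M := Subalgebra.toSubmodule (Rx q) * Subalgebra.toSubmodule (Ry q) with hM
  have key : ∀ a ∈ Algebra.adjoin ℚ (Set.range (xA ℚ q) ∪ Set.range (yA ℚ q)),
      ∀ m ∈ M, a * m ∈ M := by
    intro a ha
    induction ha using Algebra.adjoin_induction with
    | mem a ha =>
      intro m hm
      induction hm using Submodule.mul_induction_on' with
      | mem_mul_mem f hf g hg =>
        rcases ha with ⟨i, rfl⟩ | ⟨i, rfl⟩
        · rw [← mul_assoc]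
          exact Submodule.mul_mem_mul ((Rx q).mul_mem (Algebra.subset_adjoin ⟨i, rfl⟩) hf) hg
        · obtain ⟨f', hf', f'', hf'', e⟩ := exists_yA_mul_eq i hf
          rw [← mul_assoc, e, add_mul, mul_assoc]
          exact M.add_mem
            (Submodule.mul_mem_mul hf' ((Ry q).mul_mem (Algebra.subset_adjoin ⟨i, rfl⟩) hg))
            (Submodule.mul_mem_mul hf'' hg)
      | add x _ y _ hx hy =>
        rw [mul_add]
        exact M.add_mem hx hy
    | algebraMap r =>
      intro m hm
      rw [← Algebra.smul_def]
      exact M.smul_mem r hm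
    | add x y _ _ hx hy =>
      intro m hm
      rw [add_mul]
      exact M.add_mem (hx m hm) (hy m hm)
    | mul x y _ _ hx hy =>
      intro m hm
      rw [mul_assoc]
      exact hx _ (hy m hm)
  rw [eq_top_iff]
  intro a _
  have h1 : (1 : SphAlg ℚ q) ∈ M := by
    simpa using Submodule.mul_mem_mul (M := Subalgebra.toSubmodule (Rx q))
      (N := Subalgebra.toSubmodule (Ry q)) (Rx q).one_mem (Ry q).one_mem
  simpa using key a (by rw [adjoin_range_xA_union_range_yA]; trivial) 1 h1

end SphAlg

theorem stmt_3 (q : ℕ) (hq : IsPrimePow q) :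
    Function.Bijective
      (Submodule.mulMap (Subalgebra.toSubmodule (Rx (q : ℚ)))
        (Subalgebra.toSubmodule (Ry (q : ℚ)))) := by
  have hq0 : (q : ℚ) ≠ 0 := Nat.cast_ne_zero.mpr hq.ne_zero
  refine ⟨SphAlg.mulMap_injective hq0, ?_⟩
  rw [← LinearMap.range_eq_top, Submodule.mulMap_range]
  exact SphAlg.toSubmodule_Rx_mul_toSubmodule_Ry q

end
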